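/- Let A be a constant n×n quaternion matrix. The system ẋ = Ax is asymptotically stable (at any t₀) if and only if every eigenvalue of the complex adjoint matrix χ_A has negative real part; equivalently, every solution x of ẋ = Ax satisfies ‖x(t)‖ → 0 as t → ∞ if and only if every eigenvalue of χ_A has negative real part. -/

import Mathlib

open Matrix Polynomial
open scoped Quaternion

noncomputable section

/-- The two complex components of a quaternion: `q = c1 q + (c2 q) * j`,
identifying `ℂ` with the real span of `1` and `i` in `ℍ`. -/
def Quaternion.c1 (q : ℍ[ℝ]) : ℂ := ⟨q.re, q.imI⟩

def Quaternion.c2 (q : ℍ[ℝ]) : ℂ := ⟨q.imJ, q.imK⟩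

/-- The embedding of `ℂ` into `ℍ` as the real span of `1` and `i`. -/
def Complex.toQuat (z : ℂ) : ℍ[ℝ] := ⟨z.re, z.im, 0, 0⟩

/-- The complex adjoint matrix `χ_A` of a quaternion matrix `A = A₁ + A₂·j`:
the block matrix `[[A₁, A₂], [-conj A₂, conj A₁]]`. -/
def chiMat {n : ℕ} (A : Matrix (Fin n) (Fin n) ℍ[ℝ]) :
    Matrix (Fin n ⊕ Fin n) (Fin n ⊕ Fin n) ℂ :=
  Matrix.fromBlocks (A.map Quaternion.c1) (A.map Quaternion.c2)
    ((-(A.map Quaternion.c2)).map (starRingEnd ℂ)) ((A.map Quaternion.c1).map (starRingEnd ℂ))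

/-- `ρ` is a standard eigenvalue of the quaternion matrix `A`: an eigenvalue of the
complex adjoint matrix `χ_A` with nonnegative imaginary part. -/
def IsStdEigenvalue {n : ℕ} (A : Matrix (Fin n) (Fin n) ℍ[ℝ]) (ρ : ℂ) : Prop :=
  (chiMat A).charpoly.IsRoot ρ ∧ 0 ≤ ρ.im

/-- `s` is the multiset of standard eigenvalues of `A` counted with multiplicity:
it has `n` elements, all with nonnegative imaginary part, and the characteristic
polynomial of `χ_A` is `∏_{z ∈ s} (X - z)·(X - conj z)`. -/
def IsStdEigs {n : ℕ} (A : Matrix (Fin n) (Fin n) ℍ[ℝ]) (s : Multiset ℂ) : Prop :=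
  Multiset.card s = n ∧ (∀ z ∈ s, 0 ≤ z.im) ∧
    (chiMat A).charpoly =
      (s.map (fun z => (X - C z) * (X - C (starRingEnd ℂ z)))).prod

/-- `x : ℝ → ℍ^n` is a solution of the linear quaternionic system `ẋ = A(t)x`. -/
def IsSol {n : ℕ} (A : ℝ → Matrix (Fin n) (Fin n) ℍ[ℝ]) (x : ℝ → Fin n → ℍ[ℝ]) : Prop :=
  ∀ t : ℝ, HasDerivAt x ((A t).mulVec (x t)) t

/-- The norm `‖x‖ = Σ_k |x_k|` on `ℍ^n`. -/
def vecNorm {n : ℕ} (x : Fin n → ℍ[ℝ]) : ℝ := ∑ k, ‖x k‖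

/-- The norm `‖A‖ = Σ_{i,j} |a_{ij}|` on `ℍ^{n×n}`. -/
def matNorm {n : ℕ} (A : Matrix (Fin n) (Fin n) ℍ[ℝ]) : ℝ := ∑ i, ∑ j, ‖A i j‖

/-- Stability (in the sense of Lyapunov) of the system `ẋ = A(t)x` at `t₀`. -/
def StableAt {n : ℕ} (A : ℝ → Matrix (Fin n) (Fin n) ℍ[ℝ]) (t₀ : ℝ) : Prop :=
  ∀ ε > (0:ℝ), ∃ δ > (0:ℝ), ∀ x : ℝ → Fin n → ℍ[ℝ], IsSol A x →
    vecNorm (x t₀) < δ → ∀ t ≥ t₀, vecNorm (x t) < ε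

/-- Asymptotic stability of the system `ẋ = A(t)x` at `t₀`. -/
def AsympStableAt {n : ℕ} (A : ℝ → Matrix (Fin n) (Fin n) ℍ[ℝ]) (t₀ : ℝ) : Prop :=
  StableAt A t₀ ∧ ∃ δ > (0:ℝ), ∀ x : ℝ → Fin n → ℍ[ℝ], IsSol A x →
    vecNorm (x t₀) < δ →
      Filter.Tendsto (fun t => vecNorm (x t)) Filter.atTop (nhds 0)

/-- `M` is a fundamental matrix of `ẋ = A(t)x`: entrywise `M'(t) = A(t)·M(t)`
and `M(t)` is invertible for every `t`. -/
def IsFundamental {n : ℕ} (A M : ℝ → Matrix (Fin n) (Fin n) ℍ[ℝ]) : Prop :=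
  (∀ (t : ℝ) (i j : Fin n), HasDerivAt (fun s => M s i j) ((A t * M t) i j) t) ∧
    ∀ t : ℝ, IsUnit (M t)

section LinearFlow

open Filter Topology

variable {E : Type*} [NormedAddCommGroup E] [NormedSpace ℂ E]

/-- The flow `t ↦ exp (t T) v` solves `y' = T y`. -/
lemma hasDerivAt_exp_ofReal_smul_apply [CompleteSpace E] (T : E →L[ℂ] E) (v : E) (t : ℝ) :
    HasDerivAt (fun s : ℝ => NormedSpace.exp ((s : ℂ) • T) v)
      (T (NormedSpace.exp ((t : ℂ) • T) v)) t := by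
  have h := (hasDerivAt_exp_smul_const' T (t : ℂ)).clm_apply (hasDerivAt_const (t : ℂ) v)
  simpa [Function.comp_def] using h.scomp t Complex.ofRealCLM.hasDerivAt

/-- Every solution of `y' = T y` is given by the exponential flow. -/
lemma eq_exp_ofReal_smul_apply [CompleteSpace E] (T : E →L[ℂ] E) {y : ℝ → E}
    (hy : ∀ t, HasDerivAt y (T (y t)) t) (t₀ t : ℝ) :
    y t = NormedSpace.exp (((t - t₀ : ℝ) : ℂ) • T) (y t₀) := by
  have hz : ∀ t, HasDerivAt (fun s : ℝ => NormedSpace.exp (((s - t₀ : ℝ) : ℂ) • T) (y t₀))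
      (T (NormedSpace.exp (((t - t₀ : ℝ) : ℂ) • T) (y t₀))) t := fun t =>
    (hasDerivAt_exp_ofReal_smul_apply T (y t₀) (t - t₀)).comp_sub_const t t₀
  have h := ODE_solution_unique_univ (v := fun _ => T) (s := fun _ => Set.univ) (t₀ := t₀)
    (fun _ => T.lipschitz.lipschitzOnWith) (fun t => ⟨hy t, Set.mem_univ _⟩)
    (fun t => ⟨hz t, Set.mem_univ _⟩) (by simp [NormedSpace.exp_zero])
  exact congrFun h t

lemma tendsto_pow_mul_cexp_atTop_nhds_zero {l : ℂ} (hl : l.re < 0) (k : ℕ) :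
    Tendsto (fun t : ℝ => (t : ℂ) ^ k * Complex.exp (t * l)) atTop (𝓝 0) := by
  rw [tendsto_zero_iff_norm_tendsto_zero]
  have h := tendsto_rpow_mul_exp_neg_mul_atTop_nhds_zero k (-l.re) (by linarith)
  refine h.congr' ?_
  filter_upwards [eventually_ge_atTop (0 : ℝ)] with t ht
  simp [Complex.norm_exp, abs_of_nonneg ht, mul_comm]

/-- On a generalized eigenvector the exponential flow is `e ^ (t l)` times a polynomial in `t`. -/
lemma exp_smul_apply_of_pow_sub_smul_one_apply_eq_zero [CompleteSpace E] (T : E →L[ℂ] E)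
    {l : ℂ} {k : ℕ} {v : E} (hv : ((T - l • 1) ^ k) v = 0) (z : ℂ) :
    NormedSpace.exp (z • T) v = ∑ i ∈ Finset.range k,
      (z ^ i * Complex.exp (z * l)) • (i.factorial : ℂ)⁻¹ • ((T - l • 1) ^ i) v := by
  let _ : NormedAlgebra ℚ (E →L[ℂ] E) := NormedAlgebra.restrictScalars ℚ ℂ _
  have hsplit : z • T = algebraMap ℂ (E →L[ℂ] E) (z * l) + z • (T - l • 1) := by
    rw [Algebra.algebraMap_eq_smul_one, smul_sub, smul_smul]
    abel
  have hsum := (ContinuousLinearMap.apply ℂ E v).hasSum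
    (NormedSpace.exp_series_hasSum_exp' (𝕂 := ℂ) (z • (T - l • 1)))
  have hfin : NormedSpace.exp (z • (T - l • 1)) v = ∑ i ∈ Finset.range k,
      (i.factorial : ℂ)⁻¹ • z ^ i • ((T - l • 1) ^ i) v := by
    refine hsum.unique ?_
    simp only [_root_.smul_pow, ContinuousLinearMap.apply_apply, _root_.smul_apply]
    refine hasSum_sum_of_ne_finset_zero fun i hi => ?_
    obtain ⟨j, rfl⟩ := Nat.exists_eq_add_of_le' (not_lt.mp (Finset.mem_range.not.mp hi))
    rw [pow_add (T - l • 1), mul_apply_eq_comp, hv, map_zero, smul_zero, smul_zero]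
  rw [hsplit, NormedSpace.exp_add_of_commute (Algebra.commutes _ _),
    ← NormedSpace.algebraMap_exp_comm, ← Complex.exp_eq_exp_ℂ, mul_apply_eq_comp, hfin,
    Algebra.algebraMap_eq_smul_one, _root_.smul_apply,
    one_apply_eq_self, Finset.smul_sum]
  refine Finset.sum_congr rfl fun i _ => ?_
  simp only [smul_smul]
  congr 1
  ring

/-- If all eigenvalues of `T` have negative real part, the exponential flow of `T` decays. -/
lemma tendsto_exp_ofReal_smul_apply [FiniteDimensional ℂ E] (T : E →L[ℂ] E)
    (hT : ∀ l : ℂ, Module.End.HasEigenvalue (T : E →ₗ[ℂ] E) l → l.re < 0) (v : E) :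
    Tendsto (fun t : ℝ => NormedSpace.exp ((t : ℂ) • T) v) atTop (𝓝 0) := by
  have : CompleteSpace E := FiniteDimensional.complete ℂ E
  have hv : v ∈ ⨆ l, Module.End.maxGenEigenspace (T : E →ₗ[ℂ] E) l := by
    rw [Module.End.iSup_maxGenEigenspace_eq_top]
    exact Submodule.mem_top
  refine Submodule.iSup_induction _
    (motive := fun v => Tendsto (fun t : ℝ => NormedSpace.exp ((t : ℂ) • T) v) atTop (𝓝 0))
    hv (fun l x hx => ?_) (by simp) (fun x y hx hy => by simpa using hx.add hy)
  · obtain rfl | hx0 := eq_or_ne x 0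
    · simp
    obtain ⟨k, hk⟩ := (Module.End.mem_maxGenEigenspace _ _ _).mp hx
    have hl : l.re < 0 := by
      refine hT l (Module.End.hasEigenvalue_of_hasGenEigenvalue (k := k) fun h => hx0 ?_)
      have : x ∈ Module.End.genEigenspace (T : E →ₗ[ℂ] E) l k :=
        Module.End.mem_genEigenspace_nat.mpr hk
      rwa [h] at this
    have hk' : ((T - l • 1) ^ k) x = 0 := by
      rw [← hk, ← ContinuousLinearMap.coe_coe, ContinuousLinearMap.toLinearMap_pow]
      rfl
    simp_rw [exp_smul_apply_of_pow_sub_smul_one_apply_eq_zero T hk']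
    rw [← Finset.sum_const_zero (s := Finset.range k)]
    refine tendsto_finsetSum _ fun i _ => ?_
    simpa using (tendsto_pow_mul_cexp_atTop_nhds_zero hl i).smul_const
      ((i.factorial : ℂ)⁻¹ • ((T - l • 1) ^ i) x)

/-- A pointwise decaying exponential flow is uniformly bounded in forward time. -/
lemma exists_norm_exp_ofReal_smul_le [CompleteSpace E] (T : E →L[ℂ] E)
    (hT : ∀ v, Tendsto (fun t : ℝ => NormedSpace.exp ((t : ℂ) • T) v) atTop (𝓝 0)) :
    ∃ M, ∀ t : ℝ, 0 ≤ t → ‖NormedSpace.exp ((t : ℂ) • T)‖ ≤ M := by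
  obtain ⟨M, hM⟩ := banach_steinhaus
    (g := fun t : Set.Ici (0 : ℝ) => NormedSpace.exp (((t : ℝ) : ℂ) • T)) fun v => by
      obtain ⟨a, ha⟩ := eventually_atTop.mp
        ((hT v).norm.eventually (gt_mem_nhds (by simp : ‖(0 : E)‖ < 1)))
      have hcont : Continuous fun t : ℝ => NormedSpace.exp ((t : ℂ) • T) v :=
        continuous_iff_continuousAt.mpr fun t =>
          (hasDerivAt_exp_ofReal_smul_apply T v t).continuousAt
      obtain ⟨C, hC⟩ := isCompact_Icc.exists_bound_of_continuousOn
        (hcont.continuousOn (s := Set.Icc 0 a))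
      refine ⟨max C 1, fun t => ?_⟩
      obtain h | h := le_total (t : ℝ) a
      · exact (hC t ⟨t.2, h⟩).trans (le_max_left _ _)
      · exact (ha t h).le.trans (le_max_right _ _)
  exact ⟨M, fun t ht => hM ⟨t, ht⟩⟩

end LinearFlow

section ComplexAdjoint

open Filter Topology

/-- The real-linear identification `x₁ + x₂ j ↦ (x₁, -conj x₂)` of `ℍ^n` with `ℂ^{2n}`,
which intertwines `A` with `χ_A`. -/
def quatVecEquiv (n : ℕ) : (Fin n → ℍ[ℝ]) ≃L[ℝ] (Fin n ⊕ Fin n → ℂ) :=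
  LinearEquiv.toContinuousLinearEquiv
    { toFun := fun x => Sum.elim (fun k => (x k).c1) (fun k => -starRingEnd ℂ (x k).c2)
      invFun := fun y k =>
        ⟨(y (Sum.inl k)).re, (y (Sum.inl k)).im, -(y (Sum.inr k)).re, (y (Sum.inr k)).im⟩
      map_add' := fun x y => by
        ext (k | k) <;> apply Complex.ext <;> simp [Quaternion.c1, Quaternion.c2] <;> ring
      map_smul' := fun r x => by
        ext (k | k) <;> apply Complex.ext <;> simp [Quaternion.c1, Quaternion.c2]
      left_inv := fun x => by
        ext k <;> simp [Quaternion.c1, Quaternion.c2]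
      right_inv := fun y => by
        ext (k | k) <;> apply Complex.ext <;> simp [Quaternion.c1, Quaternion.c2] }

lemma quatVecEquiv_apply {n : ℕ} (x : Fin n → ℍ[ℝ]) :
    quatVecEquiv n x = Sum.elim (fun k => (x k).c1) (fun k => -starRingEnd ℂ (x k).c2) := rfl

lemma quatVecEquiv_mulVec {n : ℕ} (A : Matrix (Fin n) (Fin n) ℍ[ℝ]) (x : Fin n → ℍ[ℝ]) :
    quatVecEquiv n (A *ᵥ x) = chiMat A *ᵥ quatVecEquiv n x := by
  let c1Hom : ℍ[ℝ] →+ ℂ :=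
    { toFun := Quaternion.c1
      map_zero' := rfl
      map_add' := fun _ _ => rfl }
  let c2Hom : ℍ[ℝ] →+ ℂ :=
    { toFun := Quaternion.c2
      map_zero' := rfl
      map_add' := fun _ _ => rfl }
  have h1 : ∀ f : Fin n → ℍ[ℝ], (∑ k, f k).c1 = ∑ k, (f k).c1 := fun f =>
    map_sum c1Hom f Finset.univ
  have h2 : ∀ f : Fin n → ℍ[ℝ], (∑ k, f k).c2 = ∑ k, (f k).c2 := fun f =>
    map_sum c2Hom f Finset.univ
  rw [quatVecEquiv_apply, quatVecEquiv_apply, chiMat, Matrix.fromBlocks_mulVec]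
  ext (i | i)
  · simp only [Sum.elim_inl, Sum.elim_comp_inl, Sum.elim_comp_inr, Pi.add_apply, Matrix.mulVec,
      dotProduct, h1, ← Finset.sum_add_distrib]
    refine Finset.sum_congr rfl fun k _ => ?_
    apply Complex.ext <;> simp [Quaternion.c1, Quaternion.c2] <;> ring
  · simp only [Sum.elim_inr, Sum.elim_comp_inl, Sum.elim_comp_inr, Pi.add_apply, Matrix.mulVec,
      dotProduct, h2, map_sum, ← Finset.sum_neg_distrib, ← Finset.sum_add_distrib]
    refine Finset.sum_congr rfl fun k _ => ?_
    apply Complex.ext <;> simp [Quaternion.c1, Quaternion.c2] <;> ring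

/-- The complex adjoint matrix as a continuous linear endomorphism of `ℂ^{2n}`. -/
def chiCLM {n : ℕ} (A : Matrix (Fin n) (Fin n) ℍ[ℝ]) :
    (Fin n ⊕ Fin n → ℂ) →L[ℂ] (Fin n ⊕ Fin n → ℂ) :=
  LinearMap.toContinuousLinearMap (Matrix.toLin' (chiMat A))

lemma hasEigenvalue_chiCLM_iff {n : ℕ} (A : Matrix (Fin n) (Fin n) ℍ[ℝ]) (l : ℂ) :
    Module.End.HasEigenvalue (chiCLM A : (Fin n ⊕ Fin n → ℂ) →ₗ[ℂ] (Fin n ⊕ Fin n → ℂ)) l ↔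
      (chiMat A).charpoly.IsRoot l := by
  rw [Module.End.hasEigenvalue_iff_isRoot_charpoly, chiCLM, LinearMap.coe_toContinuousLinearMap,
    Matrix.charpoly_toLin']

lemma isSol_iff_quatVecEquiv {n : ℕ} (A : Matrix (Fin n) (Fin n) ℍ[ℝ])
    (x : ℝ → Fin n → ℍ[ℝ]) :
    IsSol (fun _ => A) x ↔ ∀ t, HasDerivAt (fun s => quatVecEquiv n (x s))
      (chiCLM A (quatVecEquiv n (x t))) t := by
  have hχ : ∀ t, chiCLM A (quatVecEquiv n (x t)) = quatVecEquiv n (A *ᵥ x t) := fun t => by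
    rw [quatVecEquiv_mulVec]
    rfl
  simp_rw [hχ]
  refine ⟨fun h t => (quatVecEquiv n).hasFDerivAt.comp_hasDerivAt t (h t), fun h t => ?_⟩
  simpa [Function.comp_def] using (quatVecEquiv n).symm.hasFDerivAt.comp_hasDerivAt t (h t)

lemma norm_le_vecNorm {n : ℕ} (x : Fin n → ℍ[ℝ]) : ‖x‖ ≤ vecNorm x :=
  (pi_norm_le_iff_of_nonneg (Finset.sum_nonneg fun _ _ => norm_nonneg _)).mpr fun k =>
    Finset.single_le_sum (f := fun k => ‖x k‖) (fun _ _ => norm_nonneg _) (Finset.mem_univ k)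

lemma vecNorm_le_card_mul_norm {n : ℕ} (x : Fin n → ℍ[ℝ]) : vecNorm x ≤ n * ‖x‖ := by
  simpa [vecNorm] using Finset.sum_le_card_nsmul Finset.univ (fun k => ‖x k‖) ‖x‖
    fun k _ => norm_le_pi_norm x k

lemma tendsto_vecNorm_zero_iff {n : ℕ} {ι : Type*} {f : Filter ι} (x : ι → Fin n → ℍ[ℝ]) :
    Tendsto (fun t => vecNorm (x t)) f (𝓝 0) ↔
      Tendsto (fun t => quatVecEquiv n (x t)) f (𝓝 0) := by
  have hx : Tendsto (fun t => vecNorm (x t)) f (𝓝 0) ↔ Tendsto x f (𝓝 0) := by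
    rw [tendsto_zero_iff_norm_tendsto_zero (f := x)]
    refine ⟨fun h => squeeze_zero (fun _ => norm_nonneg _) (fun _ => norm_le_vecNorm _) h,
      fun h => squeeze_zero (fun _ => Finset.sum_nonneg fun _ _ => norm_nonneg _)
        (fun _ => vecNorm_le_card_mul_norm _) (by simpa using h.const_mul (n : ℝ))⟩
  rw [hx]
  have h := (quatVecEquiv n).toHomeomorph.isInducing.tendsto_nhds_iff (f := x) (l := f) (y := 0)
  simpa [Function.comp_def] using h

lemma vecNorm_smul {n : ℕ} (c : ℝ) (x : Fin n → ℍ[ℝ]) : vecNorm (c • x) = |c| * vecNorm x := by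
  simp [vecNorm, norm_smul, Finset.mul_sum]

/-- Asymptotic stability of a constant system forces all its solutions to tend to `0`. -/
lemma AsympStableAt.tendsto_vecNorm {n : ℕ} {A : Matrix (Fin n) (Fin n) ℍ[ℝ]} {t₀ : ℝ}
    (h : AsympStableAt (fun _ => A) t₀) {x : ℝ → Fin n → ℍ[ℝ]} (hx : IsSol (fun _ => A) x) :
    Tendsto (fun t => vecNorm (x t)) atTop (𝓝 0) := by
  obtain ⟨-, δ, hδ, hlim⟩ := h
  have hnonneg : 0 ≤ vecNorm (x t₀) := Finset.sum_nonneg fun _ _ => norm_nonneg _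
  set c : ℝ := δ / (vecNorm (x t₀) + 1) with hc
  have hcpos : 0 < c := by positivity
  have hsol : IsSol (fun _ => A) (fun t => c • x t) := fun t => by
    rw [Matrix.mulVec_smul]
    exact (hx t).const_smul c
  have hsmall : vecNorm (c • x t₀) < δ := by
    rw [vecNorm_smul, abs_of_pos hcpos, hc, div_mul_eq_mul_div, div_lt_iff₀ (by positivity)]
    nlinarith
  have hlim' := (hlim _ hsol hsmall).const_mul c⁻¹
  simpa [vecNorm_smul, abs_of_pos hcpos, hcpos.ne'] using hlim'

/-- If all solutions tend to `0`, every eigenvalue of the complex adjoint has negative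
real part. -/
lemma re_neg_of_forall_tendsto {n : ℕ} {A : Matrix (Fin n) (Fin n) ℍ[ℝ]}
    (h : ∀ x : ℝ → Fin n → ℍ[ℝ], IsSol (fun _ => A) x →
      Tendsto (fun t => vecNorm (x t)) atTop (𝓝 0))
    {l : ℂ} (hl : (chiMat A).charpoly.IsRoot l) : l.re < 0 := by
  obtain ⟨v, hv⟩ := ((hasEigenvalue_chiCLM_iff A l).mpr hl).exists_hasEigenvector
  have hTv : chiCLM A v = l • v := hv.apply_eq_smul
  have hd : ∀ t : ℝ, HasDerivAt (fun s : ℝ => Complex.exp (s * l) • v)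
      (chiCLM A (Complex.exp (t * l) • v)) t := fun t => by
    have h1 := ((hasDerivAt_id (t : ℂ)).mul_const l).cexp.comp_ofReal.smul_const v
    simpa [hTv, smul_smul] using h1
  have hlim := h (fun t => (quatVecEquiv n).symm (Complex.exp (t * l) • v))
    ((isSol_iff_quatVecEquiv A _).mpr (by simpa using hd))
  rw [tendsto_vecNorm_zero_iff] at hlim
  simp only [ContinuousLinearEquiv.apply_symm_apply] at hlim
  by_contra! hre
  have hvpos : 0 < ‖v‖ := norm_pos_iff.mpr hv.2
  have hle : ‖v‖ ≤ ‖(0 : Fin n ⊕ Fin n → ℂ)‖ := by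
    refine ge_of_tendsto hlim.norm ?_
    filter_upwards [eventually_ge_atTop (0 : ℝ)] with t ht
    rw [norm_smul, Complex.norm_exp]
    refine le_mul_of_one_le_left hvpos.le (Real.one_le_exp ?_)
    simpa using mul_nonneg ht hre
  rw [norm_zero] at hle
  exact absurd hle hvpos.not_ge

/-- If every eigenvalue of the complex adjoint has negative real part, the system is
asymptotically stable. -/
lemma asympStableAt_of_forall_re_neg {n : ℕ} {A : Matrix (Fin n) (Fin n) ℍ[ℝ]}
    (h : ∀ l : ℂ, (chiMat A).charpoly.IsRoot l → l.re < 0) (t₀ : ℝ) :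
    AsympStableAt (fun _ => A) t₀ := by
  have hdecay := tendsto_exp_ofReal_smul_apply (chiCLM A) fun l hl =>
    h l ((hasEigenvalue_chiCLM_iff A l).mp hl)
  have hflow : ∀ x, IsSol (fun _ => A) x → ∀ t, quatVecEquiv n (x t) =
      NormedSpace.exp (((t - t₀ : ℝ) : ℂ) • chiCLM A) (quatVecEquiv n (x t₀)) := fun x hx t =>
    eq_exp_ofReal_smul_apply (chiCLM A) ((isSol_iff_quatVecEquiv A x).mp hx) t₀ t
  refine ⟨fun ε hε => ?_, 1, one_pos, fun x hx _ => ?_⟩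
  · obtain ⟨M, hM⟩ := exists_norm_exp_ofReal_smul_le (chiCLM A) hdecay
    have hM0 : 0 ≤ M := (norm_nonneg _).trans (hM 0 le_rfl)
    set φ : (Fin n → ℍ[ℝ]) →L[ℝ] (Fin n ⊕ Fin n → ℂ) := (quatVecEquiv n).toContinuousLinearMap with hφ
    set ψ : (Fin n ⊕ Fin n → ℂ) →L[ℝ] (Fin n → ℍ[ℝ]) :=
      (quatVecEquiv n).symm.toContinuousLinearMap
      with hψ
    set K : ℝ := n * (‖ψ‖ * (M * ‖φ‖)) with hK
    have hK0 : 0 ≤ K := by positivity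
    refine ⟨ε / (K + 1), by positivity, fun x hx hx0 t ht => ?_⟩
    have hxt : ‖x t‖ ≤ ‖ψ‖ * (M * (‖φ‖ * ‖x t₀‖)) := by
      calc ‖x t‖ = ‖ψ (quatVecEquiv n (x t))‖ := by simp [hψ]
        _ ≤ ‖ψ‖ * ‖quatVecEquiv n (x t)‖ := ψ.le_opNorm _
        _ ≤ ‖ψ‖ * (M * ‖φ (x t₀)‖) := by
          rw [hflow x hx t]
          gcongr
          exact ContinuousLinearMap.le_of_opNorm_le _ (hM _ (sub_nonneg.mpr ht)) _
        _ ≤ ‖ψ‖ * (M * (‖φ‖ * ‖x t₀‖)) := by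
          gcongr
          exact φ.le_opNorm _
    calc vecNorm (x t) ≤ n * ‖x t‖ := vecNorm_le_card_mul_norm _
      _ ≤ n * (‖ψ‖ * (M * (‖φ‖ * ‖x t₀‖))) := by gcongr
      _ = K * ‖x t₀‖ := by rw [hK]; ring
      _ ≤ K * vecNorm (x t₀) := by gcongr; exact norm_le_vecNorm _
      _ ≤ K * (ε / (K + 1)) := by gcongr
      _ < ε := by
        rw [mul_div_assoc', div_lt_iff₀ (by positivity)]
        nlinarith
  · rw [tendsto_vecNorm_zero_iff]
    rw [tendsto_congr (hflow x hx)]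
    exact (hdecay (quatVecEquiv n (x t₀))).comp (tendsto_atTop_add_const_right _ (-t₀) tendsto_id)

end ComplexAdjoint

/-- `ẋ = Ax` is asymptotically stable iff every eigenvalue of `χ_A` has
negative real part; equivalently, every solution tends to `0` iff every eigenvalue of
`χ_A` has negative real part. -/
theorem stmt7 {n : ℕ} (A : Matrix (Fin n) (Fin n) ℍ[ℝ]) (t₀ : ℝ) :
    (AsympStableAt (fun _ => A) t₀ ↔
      ∀ l : ℂ, (chiMat A).charpoly.IsRoot l → l.re < 0) ∧
    ((∀ x : ℝ → Fin n → ℍ[ℝ], IsSol (fun _ => A) x →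
        Filter.Tendsto (fun t => vecNorm (x t)) Filter.atTop (nhds 0)) ↔
      ∀ l : ℂ, (chiMat A).charpoly.IsRoot l → l.re < 0) := by
  refine ⟨⟨fun h l hl => re_neg_of_forall_tendsto (fun x hx => h.tendsto_vecNorm hx) hl,
    fun h => asympStableAt_of_forall_re_neg h t₀⟩,
    fun h l hl => re_neg_of_forall_tendsto h hl,
    fun h x hx => (asympStableAt_of_forall_re_neg h t₀).tendsto_vecNorm hx⟩
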